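/- arXiv:2503.13614 — 3 statements merged into one kernel-verified Lean document; each statement's English description precedes it below -/
import Mathlib

section
/- Let n ≤ M and let λ_1 ≥ λ_2 ≥ ⋯ ≥ λ_M be the eigenvalues of the symmetric matrix C, counted with multiplicity in decreasing order. Then for every orthonormal set {ψ^1, …, ψ^n} in H, Σ_{α=1}^n ⟨Γ*Γψ^α, ψ^α⟩_H ≤ Σ_{α=1}^n λ_α. -/
open RealInnerProductSpace

/-- A weighted sum of an antitone family is at most the sum of its first `n` terms, when the weights
lie in `[0, 1]`, have total at most `n`, and the family is nonnegative. -/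
theorem sum_mul_le_sum_castLE_of_antitone {M n : ℕ} (hn : n ≤ M) {lam c : Fin M → ℝ}
    (h_anti : Antitone lam) (hlam : ∀ a, 0 ≤ lam a) (hc0 : ∀ a, 0 ≤ c a) (hc1 : ∀ a, c a ≤ 1)
    (hcn : ∑ a, c a ≤ n) :
    ∑ a, lam a * c a ≤ ∑ α : Fin n, lam (Fin.castLE hn α) := by
  obtain ⟨k, rfl⟩ := Nat.exists_eq_add_of_le hn
  obtain ⟨m, hm0, hm1, hm2⟩ : ∃ m : ℝ, 0 ≤ m ∧ (∀ i : Fin n, m ≤ lam (Fin.castAdd k i)) ∧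
      ∀ j : Fin k, lam (Fin.natAdd n j) ≤ m := by
    rcases Nat.eq_zero_or_pos k with rfl | hk
    · exact ⟨0, le_rfl, fun i => hlam _, fun j => j.elim0⟩
    · refine ⟨lam (Fin.natAdd n ⟨0, hk⟩), hlam _, fun i => h_anti ?_, fun j => h_anti ?_⟩
      · simp only [Fin.le_def, Fin.val_castAdd, Fin.val_natAdd]; omega
      · simp only [Fin.le_def, Fin.val_natAdd]; omega
  have head : ∑ i : Fin n, (lam (Fin.castAdd k i) - m) * c (Fin.castAdd k i)
      ≤ ∑ i : Fin n, (lam (Fin.castAdd k i) - m) :=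
    Finset.sum_le_sum fun i _ => mul_le_of_le_one_right (sub_nonneg.2 (hm1 i)) (hc1 _)
  have tail : ∑ j : Fin k, (lam (Fin.natAdd n j) - m) * c (Fin.natAdd n j) ≤ 0 :=
    Finset.sum_nonpos fun j _ => mul_nonpos_of_nonpos_of_nonneg (sub_nonpos.2 (hm2 j)) (hc0 _)
  have total := mul_le_mul_of_nonneg_left hcn hm0
  rw [Fin.sum_univ_add] at total ⊢
  simp only [sub_mul, Finset.sum_sub_distrib, ← Finset.mul_sum, Finset.sum_const,
    Finset.card_univ, Fintype.card_fin, nsmul_eq_mul] at head tail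
  change _ ≤ ∑ i : Fin n, lam (Fin.castAdd k i)
  linarith

/-- Parseval's identity for the rows of a real orthogonal matrix. -/
theorem sum_sq_sum_mul_eq_of_orthonormal_rows {ι : Type*} [Fintype ι] [DecidableEq ι]
    {γ : ι → ι → ℝ} (hγ : ∀ a b, ∑ i, γ a i * γ b i = if a = b then 1 else 0) (f : ι → ℝ) :
    ∑ a, (∑ i, γ a i * f i) ^ 2 = ∑ i, f i ^ 2 := by
  let A : Matrix ι ι ℝ := Matrix.of γ
  have hA : A * A.transpose = 1 := by
    ext a b
    simp [A, Matrix.mul_apply, hγ, Matrix.one_apply]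
  have hdot : A.mulVec f ⬝ᵥ A.mulVec f = f ⬝ᵥ f := by
    rw [Matrix.dotProduct_mulVec, ← Matrix.mulVec_transpose, Matrix.mulVec_mulVec,
      mul_eq_one_comm.1 hA, Matrix.one_mulVec]
  simpa [dotProduct, Matrix.mulVec, A, sq] using hdot

/-- Combining the snapshots along eigenvectors of their Gram matrix gives an orthogonal family with
squared norms the eigenvalues. -/
theorem inner_sum_smul_eq_of_gram_eigenvectors {H ι : Type*} [NormedAddCommGroup H]
    [InnerProductSpace ℝ H] [Fintype ι] [DecidableEq ι] {w : ι → H} {lam : ι → ℝ}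
    {γ : ι → ι → ℝ} (hγ : ∀ a b, ∑ i, γ a i * γ b i = if a = b then 1 else 0)
    (h_eig : ∀ a, (Matrix.of fun i j => ⟪w i, w j⟫).mulVec (γ a) = lam a • γ a) (a b : ι) :
    ⟪∑ i, γ a i • w i, ∑ i, γ b i • w i⟫ = if a = b then lam b else 0 := by
  have key (i : ι) : ∑ j, γ b j * ⟪w i, w j⟫ = lam b * γ b i := by
    simpa [Matrix.mulVec, dotProduct, mul_comm] using congrFun (h_eig b) i
  calc ⟪∑ i, γ a i • w i, ∑ i, γ b i • w i⟫
      = ∑ i, γ a i * ∑ j, γ b j * ⟪w i, w j⟫ := by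
        simp only [sum_inner, real_inner_smul_left]
        simp only [inner_sum, real_inner_smul_right]
    _ = lam b * ∑ i, γ a i * γ b i := by
        simp only [key, Finset.mul_sum]
        exact Finset.sum_congr rfl fun i _ => by ring
    _ = if a = b then lam b else 0 := by simp [hγ]

/-- Bessel's inequality for a finite orthogonal family, some members of which may vanish. -/
theorem sum_inner_sq_div_le_of_orthogonal {H ι : Type*} [NormedAddCommGroup H]
    [InnerProductSpace ℝ H] [Fintype ι] [DecidableEq ι] {u : ι → H} {lam : ι → ℝ}
    (hu : ∀ a b, ⟪u a, u b⟫ = if a = b then lam b else 0) (x : H) :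
    ∑ a, ⟪x, u a⟫ ^ 2 / lam a ≤ ‖x‖ ^ 2 := by
  set p : H := ∑ a, (⟪x, u a⟫ / lam a) • u a with hp
  have hxp : ⟪x, p⟫ = ∑ a, ⟪x, u a⟫ ^ 2 / lam a := by
    simp only [hp, inner_sum, real_inner_smul_right]
    exact Finset.sum_congr rfl fun a _ => by ring
  have hpp : ⟪p, p⟫ = ∑ a, ⟪x, u a⟫ ^ 2 / lam a := by
    simp only [hp, inner_sum, sum_inner, real_inner_smul_left, real_inner_smul_right, hu,
      mul_ite, mul_zero, Finset.sum_ite_eq', Finset.mem_univ, if_true]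
    refine Finset.sum_congr rfl fun a _ => ?_
    by_cases h : lam a = 0
    · simp [h]
    · field_simp
  have h := norm_sub_sq_real x p
  rw [← real_inner_self_eq_norm_sq p, hpp, hxp] at h
  linarith [sq_nonneg ‖x - p‖]

/-- Let `n ≤ M` and let `λ_1 ≥ λ_2 ≥ ⋯ ≥ λ_M` be the eigenvalues of the
symmetric matrix `C`, `C i j = ⟪w i, w j⟫`, counted with multiplicity in
decreasing order (witnessed by an orthonormal eigenbasis `γ^1, …, γ^M` of
`ℝ^M`).  Then for every orthonormal set `{ψ^1, …, ψ^n}` in `H` one has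
`∑_{α=1}^n ⟪Γ*Γ ψ^α, ψ^α⟫_H ≤ ∑_{α=1}^n λ_α`, where
`Γ*Γ ψ = ∑ i, ⟪ψ, w i⟫ • w i`. -/
theorem pod_rayleigh_ritz_bound {H : Type*} [NormedAddCommGroup H]
    [InnerProductSpace ℝ H] [CompleteSpace H] (M n : ℕ) (hn : n ≤ M)
    (w : Fin M → H) (lam : Fin M → ℝ) (h_anti : Antitone lam)
    (γ : Fin M → Fin M → ℝ)
    (h_orthonormal : ∀ α β, ∑ i, γ α i * γ β i = if α = β then 1 else 0)
    (h_eig : ∀ α, (Matrix.of fun i j => ⟪w i, w j⟫).mulVec (γ α) = lam α • γ α)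
    (ψ : Fin n → H) (hψ : Orthonormal ℝ ψ) :
    ∑ α : Fin n, ⟪∑ i, ⟪ψ α, w i⟫ • w i, ψ α⟫
      ≤ ∑ α : Fin n, lam (Fin.castLE hn α) := by
  set u : Fin M → H := fun a => ∑ i, γ a i • w i with hu_def
  have hu (a b : Fin M) : ⟪u a, u b⟫ = if a = b then lam b else 0 :=
    inner_sum_smul_eq_of_gram_eigenvectors h_orthonormal h_eig a b
  have hnorm (a : Fin M) : ‖u a‖ ^ 2 = lam a := by
    rw [← real_inner_self_eq_norm_sq, hu, if_pos rfl]
  have hlam (a : Fin M) : 0 ≤ lam a := hnorm a ▸ sq_nonneg _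
  have hquad (x : H) : ⟪∑ i, ⟪x, w i⟫ • w i, x⟫ = ∑ a, ⟪x, u a⟫ ^ 2 := by
    calc ⟪∑ i, ⟪x, w i⟫ • w i, x⟫ = ∑ i, ⟪x, w i⟫ ^ 2 := by
          simp only [sum_inner, real_inner_smul_left, sq]
          exact Finset.sum_congr rfl fun i _ => by rw [real_inner_comm x]
      _ = ∑ a, ⟪x, u a⟫ ^ 2 := by
          rw [← sum_sq_sum_mul_eq_of_orthonormal_rows h_orthonormal]
          simp only [hu_def, inner_sum, real_inner_smul_right]
  let c : Fin M → ℝ := fun a => ∑ α, ⟪ψ α, u a⟫ ^ 2 / lam a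
  have hmul (a : Fin M) : lam a * c a = ∑ α, ⟪ψ α, u a⟫ ^ 2 := by
    rw [Finset.mul_sum]
    refine Finset.sum_congr rfl fun α _ => ?_
    by_cases h : lam a = 0
    · have h0 : u a = 0 := by simpa [h] using hnorm a
      simp [h0]
    · field_simp
  have hc0 (a : Fin M) : 0 ≤ c a :=
    Finset.sum_nonneg fun α _ => div_nonneg (sq_nonneg _) (hlam a)
  have hc1 (a : Fin M) : c a ≤ 1 := by
    have hB : ∑ α, ⟪ψ α, u a⟫ ^ 2 ≤ lam a := by
      simpa [hnorm] using hψ.sum_inner_products_le (u a) (s := Finset.univ)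
    simpa only [c, ← Finset.sum_div] using div_le_one_of_le₀ hB (hlam a)
  have hcn : ∑ a, c a ≤ n := by
    rw [Finset.sum_comm]
    calc ∑ α, ∑ a, ⟪ψ α, u a⟫ ^ 2 / lam a ≤ ∑ α, ‖ψ α‖ ^ 2 :=
          Finset.sum_le_sum fun α _ => sum_inner_sq_div_le_of_orthogonal hu (ψ α)
      _ = n := by simp [hψ.norm_eq_one]
  calc ∑ α, ⟪∑ i, ⟪ψ α, w i⟫ • w i, ψ α⟫ = ∑ a, lam a * c a := by
        simp only [hquad, hmul]
        exact Finset.sum_comm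
    _ ≤ ∑ α : Fin n, lam (Fin.castLE hn α) :=
        sum_mul_le_sum_castLE_of_antitone hn h_anti hlam hc0 hc1 hcn
end

section
/- Let n ≤ M and let λ_1 ≥ λ_2 ≥ ⋯ ≥ λ_M be the eigenvalues of C in decreasing order counted with multiplicity. Then for every choice of vectors a^1, …, a^n ∈ ℝ^M and every choice of elements ψ_1, …, ψ_n ∈ H, one has Σ_{i=1}^M ‖w_i − Σ_{α=1}^n a^α_i ψ_α‖_H² ≥ Σ_{α=n+1}^M λ_α. -/
open RealInnerProductSpace

section Auxiliary

variable {H : Type*} [NormedAddCommGroup H] [InnerProductSpace ℝ H] {ι κ : Type*}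

/-- The squared norm of a linear combination of pairwise orthogonal vectors. -/
lemma norm_sq_sum_smul_of_orthogonal [Fintype ι] [DecidableEq ι] {v : ι → H} {l : ι → ℝ}
    (hv : ∀ i j, ⟪v i, v j⟫ = if i = j then l i else 0) (c : ι → ℝ) :
    ‖∑ i, c i • v i‖ ^ 2 = ∑ i, c i ^ 2 * l i := by
  rw [← real_inner_self_eq_norm_sq, sum_inner]
  refine Finset.sum_congr rfl fun i _ => ?_
  simp only [inner_sum, real_inner_smul_left, real_inner_smul_right, hv]
  simp
  ring

/-- Bessel's inequality for pairwise orthogonal vectors that need not be normalized. -/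
lemma sum_inner_sq_div_le_of_orthogonal_s15 [Fintype ι] [DecidableEq ι] {v : ι → H} {l : ι → ℝ}
    (hv : ∀ i j, ⟪v i, v j⟫ = if i = j then l i else 0) (e : H) :
    ∑ i, ⟪e, v i⟫ ^ 2 / l i ≤ ‖e‖ ^ 2 := by
  have hexp := norm_sub_sq_real e (∑ i, (⟪e, v i⟫ / l i) • v i)
  have hinner : ⟪e, ∑ i, (⟪e, v i⟫ / l i) • v i⟫ = ∑ i, ⟪e, v i⟫ ^ 2 / l i := by
    rw [inner_sum]
    refine Finset.sum_congr rfl fun i _ => ?_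
    rw [real_inner_smul_right]
    ring
  have hnorm : ‖∑ i, (⟪e, v i⟫ / l i) • v i‖ ^ 2 = ∑ i, ⟪e, v i⟫ ^ 2 / l i := by
    rw [norm_sq_sum_smul_of_orthogonal hv]
    refine Finset.sum_congr rfl fun i _ => ?_
    rcases eq_or_ne (l i) 0 with h | h
    · simp [h]
    · field_simp
  rw [hinner, hnorm] at hexp
  linarith [sq_nonneg ‖e - ∑ i, (⟪e, v i⟫ / l i) • v i‖]

/-- The distance from `v` to a combination of orthonormal vectors is at least the distance
to its orthogonal projection. -/
lemma Orthonormal.norm_sq_sub_sum_inner_sq_le [Fintype κ] {e : κ → H} (he : Orthonormal ℝ e)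
    (v : H) (r : κ → ℝ) :
    ‖v‖ ^ 2 - ∑ k, ⟪e k, v⟫ ^ 2 ≤ ‖v - ∑ k, r k • e k‖ ^ 2 := by
  classical
  have hnorm := norm_sq_sum_smul_of_orthogonal (l := fun _ => 1) (orthonormal_iff_ite.mp he) r
  have hinner : ⟪v, ∑ k, r k • e k⟫ = ∑ k, r k * ⟪e k, v⟫ := by
    simp only [inner_sum, real_inner_smul_right, real_inner_comm]
  have hsq : 0 ≤ ∑ k, (r k - ⟪e k, v⟫) ^ 2 := Finset.sum_nonneg fun _ _ => sq_nonneg _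
  have hexp : ∑ k, (r k - ⟪e k, v⟫) ^ 2
      = ∑ k, r k ^ 2 * 1 - 2 * ∑ k, r k * ⟪e k, v⟫ + ∑ k, ⟪e k, v⟫ ^ 2 := by
    rw [Finset.mul_sum, ← Finset.sum_sub_distrib, ← Finset.sum_add_distrib]
    exact Finset.sum_congr rfl fun k _ => by ring
  rw [norm_sub_sq_real, hinner, hnorm]
  linarith

/-- Parseval's identity for an orthogonal change of coordinates in a finite family. -/
lemma sum_norm_sq_orthogonal_transform [Fintype ι] [DecidableEq ι] {γ : ι → ι → ℝ}
    (hγ : ∀ α β, ∑ i, γ α i * γ β i = if α = β then 1 else 0) (x : ι → H) :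
    ∑ α, ‖∑ i, γ α i • x i‖ ^ 2 = ∑ i, ‖x i‖ ^ 2 := by
  have hrow : Matrix.of γ * (Matrix.of γ).transpose = 1 := by
    ext α β
    simpa [Matrix.mul_apply, Matrix.one_apply] using hγ α β
  have hmul := mul_eq_one_comm.mp hrow
  have hcol : ∀ i j, ∑ α, γ α i * γ α j = if i = j then 1 else 0 := fun i j => by
    simpa [Matrix.mul_apply, Matrix.one_apply] using
      congrFun (congrFun hmul i) j
  calc ∑ α, ‖∑ i, γ α i • x i‖ ^ 2
      = ∑ α, ∑ i, ∑ j, (γ α i * γ α j) * ⟪x i, x j⟫ := by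
        refine Finset.sum_congr rfl fun α _ => ?_
        simp only [← real_inner_self_eq_norm_sq, sum_inner, inner_sum, real_inner_smul_left,
          real_inner_smul_right, mul_assoc]
        rw [Finset.sum_comm]
        exact Finset.sum_congr rfl fun i _ => Finset.sum_congr rfl fun j _ => by ring
    _ = ∑ i, ∑ j, (∑ α, γ α i * γ α j) * ⟪x i, x j⟫ := by
        rw [Finset.sum_comm]
        refine Finset.sum_congr rfl fun i _ => ?_
        rw [Finset.sum_comm]
        simp only [Finset.sum_mul]
    _ = ∑ i, ‖x i‖ ^ 2 := by
        simp [hcol]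

/-- Combining a family along an orthonormal eigenbasis of its Gram matrix gives pairwise
orthogonal vectors whose squared norms are the eigenvalues. -/
lemma inner_sum_smul_eigenvector_gram [Fintype ι] [DecidableEq ι] {w : ι → H} {l : ι → ℝ}
    {γ : ι → ι → ℝ} (hγ : ∀ α β, ∑ i, γ α i * γ β i = if α = β then 1 else 0)
    (heig : ∀ α, (Matrix.of fun i j => ⟪w i, w j⟫).mulVec (γ α) = l α • γ α) (α β : ι) :
    ⟪∑ i, γ α i • w i, ∑ i, γ β i • w i⟫ = if α = β then l α else 0 := by
  calc ⟪∑ i, γ α i • w i, ∑ i, γ β i • w i⟫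
      = ∑ i, γ α i * (Matrix.of fun i j => ⟪w i, w j⟫).mulVec (γ β) i := by
        simp only [sum_inner, inner_sum, real_inner_smul_left, real_inner_smul_right,
          Matrix.mulVec, dotProduct, Matrix.of_apply, Finset.mul_sum]
        rw [Finset.sum_comm]
        exact Finset.sum_congr rfl fun i _ => Finset.sum_congr rfl fun j _ => by ring
    _ = l β * ∑ i, γ α i * γ β i := by
        rw [heig, Finset.mul_sum]
        exact Finset.sum_congr rfl fun i _ => by simp only [Pi.smul_apply, smul_eq_mul]; ring
    _ = if α = β then l α else 0 := by
        rw [hγ]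
        split_ifs with h <;> simp [h]

end Auxiliary

/-- A nonnegative decreasing sequence weighted by numbers in `[0, 1]` of total weight at most
`n` sums to at most the sum of its first `n` terms. -/
lemma Antitone.sum_mul_le_sum_filter_lt {M n : ℕ} (hn : n ≤ M) {l t : Fin M → ℝ}
    (hl : Antitone l) (hl0 : ∀ i, 0 ≤ l i) (ht0 : ∀ i, 0 ≤ t i) (ht1 : ∀ i, t i ≤ 1)
    (ht : ∑ i, t i ≤ n) :
    ∑ i, l i * t i ≤ ∑ i with i.val < n, l i := by
  obtain ⟨m, hm0, hm_le, hm_ge⟩ : ∃ m : ℝ, 0 ≤ m ∧ (∀ i : Fin M, i.val < n → m ≤ l i) ∧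
      ∀ i : Fin M, ¬ i.val < n → l i ≤ m := by
    rcases hn.lt_or_eq with h | rfl
    · exact ⟨l ⟨n, h⟩, hl0 _, fun i hi => hl (Fin.le_def.mpr hi.le),
        fun i hi => hl (Fin.le_def.mpr (not_lt.mp hi))⟩
    · exact ⟨0, le_rfl, fun i _ => hl0 i, fun i hi => absurd i.isLt hi⟩
  have hcard : ∑ i : Fin M, (if i.val < n then m else 0) = n * m := by
    rw [← Finset.sum_filter, Finset.sum_const, nsmul_eq_mul, Fin.card_filter_val_lt,
      min_eq_right hn]
  have hterm : ∀ i, l i * t i ≤ (if i.val < n then l i else 0)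
      - (if i.val < n then m else 0) + m * t i := by
    intro i
    split_ifs with h
    · nlinarith [hm_le i h, ht1 i]
    · nlinarith [hm_ge i h, ht0 i]
  have hsum := Finset.sum_le_sum fun i (_ : i ∈ Finset.univ) => hterm i
  rw [Finset.sum_add_distrib, Finset.sum_sub_distrib, hcard, ← Finset.mul_sum,
    ← Finset.sum_filter] at hsum
  nlinarith [mul_le_mul_of_nonneg_left ht hm0]

/-- Let `n ≤ M` and let `λ_1 ≥ λ_2 ≥ ⋯ ≥ λ_M` be the eigenvalues of `C`,
`C i j = ⟪w i, w j⟫`, in decreasing order counted with multiplicity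
(witnessed by an orthonormal eigenbasis `γ^1, …, γ^M` of `ℝ^M`).  Then for
every choice of vectors `a^1, …, a^n ∈ ℝ^M` and elements `ψ_1, …, ψ_n ∈ H`,
`∑_{i=1}^M ‖w_i − ∑_{α=1}^n a^α_i ψ_α‖² ≥ ∑_{α=n+1}^M λ_α`. -/
theorem pod_optimal_error_lower_bound {H : Type*} [NormedAddCommGroup H]
    [InnerProductSpace ℝ H] [CompleteSpace H] (M n : ℕ) (hn : n ≤ M)
    (w : Fin M → H) (lam : Fin M → ℝ) (h_anti : Antitone lam)
    (γ : Fin M → Fin M → ℝ)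
    (h_orthonormal : ∀ α β, ∑ i, γ α i * γ β i = if α = β then 1 else 0)
    (h_eig : ∀ α, (Matrix.of fun i j => ⟪w i, w j⟫).mulVec (γ α) = lam α • γ α)
    (a : Fin n → Fin M → ℝ) (ψ : Fin n → H) :
    ∑ α ∈ Finset.univ.filter (fun α : Fin M => n ≤ (α : ℕ)), lam α
      ≤ ∑ i, ‖w i - ∑ α, a α i • ψ α‖ ^ 2 := by
  classical
  set v : Fin M → H := fun α => ∑ i, γ α i • w i with hv
  have horth : ∀ α β, ⟪v α, v β⟫ = if α = β then lam α else 0 :=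
    inner_sum_smul_eigenvector_gram h_orthonormal h_eig
  have hnorm : ∀ α, ‖v α‖ ^ 2 = lam α := fun α => by
    rw [← real_inner_self_eq_norm_sq, horth, if_pos rfl]
  have hlam : ∀ α, 0 ≤ lam α := fun α => hnorm α ▸ sq_nonneg _
  let V := Submodule.span ℝ (Set.range ψ)
  have hdim : Module.finrank ℝ V ≤ n :=
    (finrank_range_le_card (R := ℝ) ψ).trans_eq (Fintype.card_fin n)
  have : FiniteDimensional ℝ V := FiniteDimensional.span_of_finite ℝ (Set.finite_range ψ)
  let b := stdOrthonormalBasis ℝ V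
  let e : Fin (Module.finrank ℝ V) → H := fun k => b k
  have he : Orthonormal ℝ e := b.orthonormal.comp_linearIsometry V.subtypeₗᵢ
  have hle : ∀ α, ∑ k, ⟪e k, v α⟫ ^ 2 ≤ lam α := fun α => by
    simpa [hnorm] using he.sum_inner_products_le (v α) (s := Finset.univ)
  have herr : ∀ α, lam α - ∑ k, ⟪e k, v α⟫ ^ 2
      ≤ ‖∑ i, γ α i • (w i - ∑ β, a β i • ψ β)‖ ^ 2 := by
    intro α
    let p : V := ⟨∑ i, γ α i • ∑ β, a β i • ψ β,
      sum_mem fun i _ => V.smul_mem _ <| sum_mem fun β _ =>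
        V.smul_mem _ <| Submodule.subset_span ⟨β, rfl⟩⟩
    have hp : ∑ k, b.repr p k • e k = ∑ i, γ α i • ∑ β, a β i • ψ β := by
      simpa [e] using congrArg V.subtype (b.sum_repr p)
    have := he.norm_sq_sub_sum_inner_sq_le (v α) (b.repr p)
    rw [hp, hnorm] at this
    simpa only [hv, smul_sub, Finset.sum_sub_distrib] using this
  have hweight : ∑ α, (∑ k, ⟪e k, v α⟫ ^ 2) / lam α ≤ n := by
    calc ∑ α, (∑ k, ⟪e k, v α⟫ ^ 2) / lam α
        = ∑ k, ∑ α, ⟪e k, v α⟫ ^ 2 / lam α := by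
          simp only [Finset.sum_div]
          exact Finset.sum_comm
      _ ≤ ∑ k, ‖e k‖ ^ 2 :=
          Finset.sum_le_sum fun k _ => sum_inner_sq_div_le_of_orthogonal_s15 horth (e k)
      _ = Module.finrank ℝ V := by simp [he.norm_eq_one]
      _ ≤ n := by exact_mod_cast hdim
  have hcaptured : ∑ α, ∑ k, ⟪e k, v α⟫ ^ 2 ≤ ∑ α with α.val < n, lam α := by
    have h0 : ∀ α, 0 ≤ ∑ k, ⟪e k, v α⟫ ^ 2 := fun α => Finset.sum_nonneg fun _ _ => sq_nonneg _
    refine le_of_eq_of_le (Finset.sum_congr rfl fun α _ => ?_)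
      (h_anti.sum_mul_le_sum_filter_lt hn hlam (fun α => div_nonneg (h0 α) (hlam α))
        (fun α => div_le_one_of_le₀ (hle α) (hlam α)) hweight)
    exact (mul_div_cancel_of_imp' fun h => le_antisymm (h ▸ hle α) (h0 α)).symm
  have hsplit := Finset.sum_filter_add_sum_filter_not Finset.univ (fun α : Fin M => α.val < n) lam
  simp only [not_lt] at hsplit
  have htotal := Finset.sum_le_sum fun α (_ : α ∈ Finset.univ) => herr α
  rw [Finset.sum_sub_distrib, sum_norm_sq_orthogonal_transform h_orthonormal] at htotal
  linarith
end

section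
/- Let n ≤ M, let λ_1 ≥ λ_2 ≥ ⋯ ≥ λ_M be the eigenvalues of C in decreasing order with corresponding orthonormal eigenvectors γ^1, …, γ^M ∈ ℝ^M, and assume λ_n > 0. Define ψ_α := (1/√λ_α) Σ_{i=1}^M γ^α_i w_i and a^α_i := √λ_α · γ^α_i for 1 ≤ α ≤ n. Then Σ_{i=1}^M ‖w_i − Σ_{α=1}^n a^α_i ψ_α‖_H² = Σ_{α=n+1}^M λ_α; i.e. the POD reconstruction attains the optimal approximation error. -/
open RealInnerProductSpace

/-- Expansion of a family of vectors along the rows of an orthogonal matrix. -/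
lemma sum_smul_sum_smul_of_orthonormal {ι E : Type*} [Fintype ι] [DecidableEq ι]
    [AddCommGroup E] [Module ℝ E] (γ : ι → ι → ℝ)
    (hγ : ∀ α β, ∑ i, γ α i * γ β i = if α = β then 1 else 0) (w : ι → E) (i : ι) :
    ∑ α, γ α i • ∑ j, γ α j • w j = w i := by
  have h_rows : Matrix.of γ * (Matrix.of γ).transpose = 1 := by
    ext α β
    simp [Matrix.mul_apply, Matrix.one_apply, hγ]
  have h_gram := mul_eq_one_comm.mp h_rows
  have h_cols : ∀ j, ∑ α, γ α i * γ α j = if i = j then 1 else 0 := fun j => by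
    simpa [Matrix.mul_apply, Matrix.one_apply] using
      congrArg (fun A => A i j) h_gram
  simp_rw [Finset.smul_sum, smul_smul]
  rw [Finset.sum_comm]
  simp_rw [← Finset.sum_smul, h_cols]
  simp

/-- Pythagorean identity for combinations whose coefficient rows are orthonormal. -/
lemma sum_norm_sq_sum_smul_of_orthonormal {ι κ E : Type*} [Fintype ι] [DecidableEq κ]
    [NormedAddCommGroup E] [InnerProductSpace ℝ E] (γ : κ → ι → ℝ)
    (hγ : ∀ α β, ∑ i, γ α i * γ β i = if α = β then 1 else 0) (v : κ → E) (s : Finset κ) :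
    ∑ i, ‖∑ α ∈ s, γ α i • v α‖ ^ 2 = ∑ α ∈ s, ‖v α‖ ^ 2 := by
  simp_rw [← real_inner_self_eq_norm_sq, sum_inner, inner_sum, real_inner_smul_left,
    real_inner_smul_right, ← mul_assoc]
  rw [Finset.sum_comm]
  refine Finset.sum_congr rfl fun α hα => ?_
  rw [Finset.sum_comm]
  simp_rw [← Finset.sum_mul, hγ]
  simp [hα]

/-- The quadratic form of the Gram matrix at a unit eigenvector is the eigenvalue. -/
lemma norm_sq_sum_smul_of_gram_mulVec {ι E : Type*} [Fintype ι]
    [NormedAddCommGroup E] [InnerProductSpace ℝ E] (w : ι → E) (c : ι → ℝ) (μ : ℝ)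
    (hc : ∑ i, c i * c i = 1)
    (h_eig : (Matrix.of fun i j => ⟪w i, w j⟫).mulVec c = μ • c) :
    ‖∑ j, c j • w j‖ ^ 2 = μ := by
  have h_row : ∀ i, ∑ j, c j * ⟪w i, w j⟫ = μ * c i := fun i => by
    simpa [Matrix.mulVec, dotProduct, mul_comm] using congrFun h_eig i
  simp_rw [← real_inner_self_eq_norm_sq, sum_inner, real_inner_smul_left, inner_sum,
    real_inner_smul_right, h_row, mul_left_comm _ μ]
  rw [← Finset.mul_sum, hc, mul_one]

lemma sum_castLE_eq_sum_filter {E : Type*} [AddCommMonoid E] {n M : ℕ} (hn : n ≤ M)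
    (f : Fin M → E) :
    ∑ α : Fin n, f (Fin.castLE hn α) = ∑ α with ¬ n ≤ (α : Fin M).val, f α := by
  refine Finset.sum_bij (fun α _ => Fin.castLE hn α) ?_ ?_ ?_ ?_
  · intro α _
    simp
  · intro α _ β _ h
    exact Fin.castLE_injective hn h
  · intro β hβ
    have hlt : β.val < n := by simpa using hβ
    exact ⟨⟨β, hlt⟩, Finset.mem_univ _, rfl⟩
  · intro α _
    rfl

/-- Let `n ≤ M`, let `λ_1 ≥ ⋯ ≥ λ_M` be the eigenvalues of `C`,
`C i j = ⟪w i, w j⟫`, in decreasing order with corresponding orthonormal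
eigenvectors `γ^1, …, γ^M` of `ℝ^M`, and assume `λ_n > 0`.  With
`ψ_α = (1/√λ_α) ∑ i, γ^α_i • w i` and `a^α_i = √λ_α γ^α_i` for `α ≤ n`,
the POD reconstruction attains the optimal approximation error:
`∑_{i=1}^M ‖w_i − ∑_{α=1}^n a^α_i ψ_α‖² = ∑_{α=n+1}^M λ_α`. -/
theorem pod_reconstruction_optimal {H : Type*} [NormedAddCommGroup H]
    [InnerProductSpace ℝ H] [CompleteSpace H] (M n : ℕ) (hn : n ≤ M)
    (hn0 : 0 < n) (w : Fin M → H) (lam : Fin M → ℝ) (h_anti : Antitone lam)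
    (γ : Fin M → Fin M → ℝ)
    (h_orthonormal : ∀ α β, ∑ i, γ α i * γ β i = if α = β then 1 else 0)
    (h_eig : ∀ α, (Matrix.of fun i j => ⟪w i, w j⟫).mulVec (γ α) = lam α • γ α)
    (h_pos : 0 < lam ⟨n - 1, by omega⟩) :
    ∑ i, ‖w i - ∑ α : Fin n,
        (Real.sqrt (lam (Fin.castLE hn α)) * γ (Fin.castLE hn α) i) •
          ((Real.sqrt (lam (Fin.castLE hn α)))⁻¹ •
            ∑ j, γ (Fin.castLE hn α) j • w j)‖ ^ 2
      = ∑ α ∈ Finset.univ.filter (fun α : Fin M => n ≤ (α : ℕ)), lam α := by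
  have h_lam : ∀ α : Fin n, 0 < lam (Fin.castLE hn α) := fun α =>
    h_pos.trans_le (h_anti (Fin.mk_le_mk.mpr (by omega)))
  have h_residual : ∀ i, w i - ∑ α : Fin n,
      (Real.sqrt (lam (Fin.castLE hn α)) * γ (Fin.castLE hn α) i) •
        ((Real.sqrt (lam (Fin.castLE hn α)))⁻¹ • ∑ j, γ (Fin.castLE hn α) j • w j)
      = ∑ α with n ≤ (α : Fin M).val, γ α i • ∑ j, γ α j • w j := fun i => by
    have h_cancel : ∀ α : Fin n,
        (Real.sqrt (lam (Fin.castLE hn α)) * γ (Fin.castLE hn α) i) •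
          ((Real.sqrt (lam (Fin.castLE hn α)))⁻¹ • ∑ j, γ (Fin.castLE hn α) j • w j)
        = γ (Fin.castLE hn α) i • ∑ j, γ (Fin.castLE hn α) j • w j := fun α => by
      have := (Real.sqrt_pos.mpr (h_lam α)).ne'
      rw [smul_smul]
      congr 1
      field_simp
    rw [Finset.sum_congr rfl fun α _ => h_cancel α,
      sum_castLE_eq_sum_filter hn fun α => γ α i • ∑ j, γ α j • w j, sub_eq_iff_eq_add,
      Finset.sum_filter_add_sum_filter_not,
      sum_smul_sum_smul_of_orthonormal γ h_orthonormal]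
  simp_rw [h_residual]
  rw [sum_norm_sq_sum_smul_of_orthonormal γ h_orthonormal]
  exact Finset.sum_congr rfl fun α _ =>
    norm_sq_sum_smul_of_gram_mulVec w (γ α) (lam α) (by simp [h_orthonormal]) (h_eig α)
end
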